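/- Assume g, h ∈ C³(ℝⁿ) and f is bounded below. Let x : [0,∞) → ℝⁿ be a bounded global solution of the continuous DCA flow ∇²g(x(t)) ẋ(t) = −∇f(x(t)), and assume f has the Kurdyka–Łojasiewicz property at every point of the omega-limit set ω(x₀) := ⋂_{s≥0} cl{x(t) : t ≥ s}. Then the trajectory has finite Euclidean length, ∫₀^∞ ‖ẋ(t)‖ dt < ∞, and x(t) converges as t → ∞ to a single point x⋆ with ∇f(x⋆) = 0. -/

import Mathlib

open Set Filter Topology Function

/-- The Kurdyka–Łojasiewicz property of `f` at a point `xs`: there are `ε > 0`, a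
neighborhood `U` of `xs`, and a concave desingularizing function
`φ ∈ C¹((0,ε)) ∩ C([0,ε))` with `φ(0) = 0`, `φ' > 0` on `(0,ε)`, such that
`φ'(f(z) − f(xs)) ‖∇f(z)‖ ≥ 1` for all `z ∈ U` with `f(xs) < f(z) < f(xs) + ε`. -/
def HasKLPropertyAt {n : ℕ} (f : EuclideanSpace ℝ (Fin n) → ℝ)
    (xs : EuclideanSpace ℝ (Fin n)) : Prop :=
  ∃ ε : ℝ, 0 < ε ∧ ∃ U ∈ 𝓝 xs, ∃ φ : ℝ → ℝ,
    ConcaveOn ℝ (Set.Ico 0 ε) φ ∧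
    φ 0 = 0 ∧
    ContinuousOn φ (Set.Ico 0 ε) ∧
    (∀ s ∈ Set.Ioo (0:ℝ) ε, DifferentiableAt ℝ φ s) ∧
    ContinuousOn (deriv φ) (Set.Ioo 0 ε) ∧
    (∀ s ∈ Set.Ioo (0:ℝ) ε, 0 < deriv φ s) ∧
    ∀ z ∈ U, f xs < f z → f z < f xs + ε →
      1 ≤ deriv φ (f z - f xs) * ‖gradient f z‖

open MeasureTheory
open scoped InnerProductSpace

section Gradient

variable {E : Type*} [NormedAddCommGroup E] [InnerProductSpace ℝ E] [CompleteSpace E]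

theorem ContDiff.gradient {g : E → ℝ} {m k : WithTop ℕ∞} (hg : ContDiff ℝ k g)
    (hm : m + 1 ≤ k) : ContDiff ℝ m (gradient g) :=
  (InnerProductSpace.toDual ℝ E).symm.toContinuousLinearEquiv.contDiff.comp (hg.fderiv_right hm)

/-- Strong convexity bounds the Hessian from below. -/
theorem mul_sq_norm_le_inner_fderiv_gradient {g : E → ℝ} {μ : ℝ} (hg : ContDiff ℝ 2 g)
    (hsc : ConvexOn ℝ univ (fun x => g x - μ / 2 * ‖x‖ ^ 2)) (y v : E) :
    μ * ‖v‖ ^ 2 ≤ ⟪fderiv ℝ (gradient g) y v, v⟫_ℝ := by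
  have hline : ∀ s : ℝ, HasDerivAt (fun s : ℝ => y + s • v) v s := fun s => by
    simpa using ((hasDerivAt_id s).smul_const v).const_add y
  have hgrad : Differentiable ℝ (gradient g) :=
    (hg.gradient (m := 1) (by norm_num)).differentiable one_ne_zero
  have hd : ∀ s : ℝ, HasDerivAt (fun s : ℝ => g (y + s • v) - μ / 2 * ‖y + s • v‖ ^ 2)
      (⟪gradient g (y + s • v), v⟫_ℝ - μ * ⟪y + s • v, v⟫_ℝ) s := fun s => by
    have h1 := ((hg.differentiable two_ne_zero) (y + s • v)).hasFDerivAt.comp_hasDerivAt s (hline s)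
    have h2 := ((hline s).norm_sq).const_mul (μ / 2)
    refine (h1.sub h2).congr_deriv ?_
    rw [inner_gradient_left]
    ring
  have hconv : ConvexOn ℝ univ (fun s : ℝ => g (y + s • v) - μ / 2 * ‖y + s • v‖ ^ 2) := by
    have := hsc.comp_affineMap (AffineMap.lineMap y (y + v) : ℝ →ᵃ[ℝ] E)
    simpa [Function.comp_def, AffineMap.lineMap_apply, add_comm] using this
  have hmono := hconv.monotoneOn_deriv fun s _ => (hd s).differentiableAt
  rw [monotoneOn_univ, funext fun s => (hd s).deriv] at hmono
  have hdd : HasDerivAt (fun s : ℝ => ⟪gradient g (y + s • v), v⟫_ℝ - μ * ⟪y + s • v, v⟫_ℝ)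
      (⟪fderiv ℝ (gradient g) (y + (0 : ℝ) • v) v, v⟫_ℝ - μ * ⟪v, v⟫_ℝ) 0 := by
    have h1 := (hgrad (y + (0 : ℝ) • v)).hasFDerivAt.comp_hasDerivAt 0 (hline 0)
    have h2 := (h1.inner ℝ (hasDerivAt_const 0 v)).sub
      (((hline 0).inner ℝ (hasDerivAt_const 0 v)).const_mul μ)
    exact h2.congr_deriv (by simp)
  have := hdd.nonneg_of_monotone hmono
  rw [zero_smul, add_zero, real_inner_self_eq_norm_sq] at this
  linarith

end Gradient

/-- A curve along which `f` decreases at rate `μ ‖x'‖²`, whose speed dominates the gradient of `f`,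
and which accumulates at a KL point of `f`, has finite length. -/
theorem exists_integrableOn_norm_of_hasKLPropertyAt {n : ℕ} {f : EuclideanSpace ℝ (Fin n) → ℝ}
    {x x' : ℝ → EuclideanSpace ℝ (Fin n)} {F' : ℝ → ℝ} {μ L : ℝ}
    (hμ : 0 < μ) (hL : 0 < L)
    (hx : ∀ t, 0 ≤ t → HasDerivAt x (x' t) t)
    (hF : ∀ t, 0 ≤ t → HasDerivAt (fun s => f (x s)) (F' t) t)
    (hF' : ∀ t, 0 ≤ t → F' t ≤ -(μ * ‖x' t‖ ^ 2))
    (hgrad : ∀ t, 0 ≤ t → ‖gradient f (x t)‖ ≤ L * ‖x' t‖)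
    {p : EuclideanSpace ℝ (Fin n)} (hp : MapClusterPt p atTop x) (hkl : HasKLPropertyAt f p)
    (hlim : Tendsto (fun t => f (x t)) atTop (𝓝 (f p))) (hpos : ∀ t, 0 ≤ t → f p < f (x t)) :
    ∃ T, 0 ≤ T ∧ IntegrableOn (fun t => ‖x' t‖) (Ioi T) := by
  obtain ⟨ε, hε, U, hU, φ, -, hφ0, hφc, hφd, -, hφpos, hφ⟩ := hkl
  obtain ⟨r, hr, hrU⟩ := Metric.mem_nhds_iff.1 hU
  set c := μ / L with hc
  have hc0 : 0 < c := div_pos hμ hL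
  set Ψ : ℝ → ℝ := fun t => φ (f (x t) - f p) with hΨ
  have hgap : Tendsto (fun t => f (x t) - f p) atTop (𝓝 0) := by
    simpa using hlim.sub_const (f p)
  have hsmall : ∀ᶠ t in atTop, f (x t) - f p < ε := hgap.eventually_lt_const hε
  have hΨlim : Tendsto Ψ atTop (𝓝 0) := by
    have h0 := hφc 0 ⟨le_rfl, hε⟩
    rw [ContinuousWithinAt, hφ0] at h0
    refine h0.comp (tendsto_nhdsWithin_iff.2 ⟨hgap, ?_⟩)
    filter_upwards [hsmall, eventually_ge_atTop 0] with t ht ht0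
    exact ⟨(sub_pos.2 (hpos t ht0)).le, ht⟩
  have hΨsmall : ∀ᶠ t in atTop, Ψ t < c * (r / 3) := hΨlim.eventually_lt_const (by positivity)
  obtain ⟨T, hTp, hT0, hTε, hTΨ⟩ : ∃ T, x T ∈ Metric.ball p (r / 3) ∧ 0 ≤ T ∧
      (∀ t, T ≤ t → f (x t) - f p < ε) ∧ Ψ T < c * (r / 3) := by
    have h1 : ∃ᶠ t in atTop, x t ∈ Metric.ball p (r / 3) :=
      hp.frequently (Metric.ball_mem_nhds p (by positivity))
    obtain ⟨T, h, h'⟩ := (h1.and_eventually ((eventually_ge_atTop 0).and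
      ((eventually_forall_ge_atTop.2 hsmall).and hΨsmall))).exists
    exact ⟨T, h, h'⟩
  have hmem : ∀ t, T ≤ t → f (x t) - f p ∈ Ioo 0 ε := fun t ht =>
    ⟨sub_pos.2 (hpos t (hT0.trans ht)), hTε t ht⟩
  have hφnonneg : ∀ s ∈ Ioo (0 : ℝ) ε, 0 < φ s := fun s hs => by
    have hmono : StrictMonoOn φ (Ico 0 ε) :=
      strictMonoOn_of_deriv_pos (convex_Ico 0 ε) hφc (by simpa using hφpos)
    simpa [hφ0] using hmono ⟨le_rfl, hε⟩ ⟨hs.1.le, hs.2⟩ hs.1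
  set Ψ' : ℝ → ℝ := fun t => deriv φ (f (x t) - f p) * F' t with hΨ'
  have hΨd : ∀ t, T ≤ t → HasDerivAt Ψ (Ψ' t) t := fun t ht =>
    (hφd _ (hmem t ht)).hasDerivAt.comp t ((hF t (hT0.trans ht)).sub_const (f p))
  have hrate : ∀ t, T ≤ t → x t ∈ Metric.ball p r → c * ‖x' t‖ ≤ -Ψ' t := fun t ht hball => by
    have h0 := hT0.trans ht
    have hd := hφpos _ (hmem t ht)
    have h1 := hφ _ (hrU hball) (hpos t h0) (by linarith [hTε t ht])
    have h2 : 1 ≤ deriv φ (f (x t) - f p) * (L * ‖x' t‖) :=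
      h1.trans (mul_le_mul_of_nonneg_left (hgrad t h0) hd.le)
    calc c * ‖x' t‖ = c * ‖x' t‖ * 1 := (mul_one _).symm
      _ ≤ c * ‖x' t‖ * (deriv φ (f (x t) - f p) * (L * ‖x' t‖)) := by gcongr
      _ = deriv φ (f (x t) - f p) * (μ * ‖x' t‖ ^ 2) := by rw [hc]; field_simp
      _ ≤ deriv φ (f (x t) - f p) * -F' t := by gcongr; linarith [hF' t h0]
      _ = -Ψ' t := by rw [hΨ']; ring
  have hmemball : ∀ t, T ≤ t → ‖x t - x T‖ < 2 * r / 3 → x t ∈ Metric.ball p r := fun t _ h => by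
    rw [Metric.mem_ball, dist_eq_norm] at *
    calc ‖x t - p‖ ≤ ‖x t - x T‖ + ‖x T - p‖ := norm_sub_le_norm_sub_add_norm_sub _ _ _
      _ < r := by linarith
  have htrap : ∀ b, T ≤ b → x b ∈ Metric.ball p r := fun b hb => by
    set η := r / (3 * (b - T + 1)) with hη
    have hbT : 0 < b - T + 1 := by linarith
    have hη0 : 0 < η := by positivity
    have hηb : η * (b - T) < r / 3 := by
      have : η * (b - T + 1) = r / 3 := by rw [hη]; field_simp
      linarith
    have hBlt : ∀ t ∈ Icc T b, (Ψ T - Ψ t) / c + η * (t - T) < 2 * r / 3 := fun t ht => by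
      have h1 : (Ψ T - Ψ t) / c < r / 3 := by
        rw [div_lt_iff₀ hc0]
        linarith [hφnonneg _ (hmem t ht.1)]
      have h2 : η * (t - T) ≤ η * (b - T) := by gcongr; exact ht.2
      linarith
    have hBd : ∀ t, T ≤ t → HasDerivAt (fun t => (Ψ T - Ψ t) / c + η * (t - T)) (-Ψ' t / c + η) t :=
      fun t ht => by
        refine ((((hΨd t ht).const_sub (Ψ T)).div_const c).add
          (((hasDerivAt_id t).sub_const T).const_mul η)).congr_deriv ?_
        rw [mul_one]
    have hxd : ∀ t, T ≤ t → HasDerivAt (fun t => x t - x T) (x' t) t := fun t ht =>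
      (hx t (hT0.trans ht)).sub_const _
    have key := image_norm_le_of_norm_deriv_right_lt_deriv_boundary' (a := T) (b := b)
      (fun t ht => (hxd t ht.1).continuousAt.continuousWithinAt)
      (fun t ht => (hxd t ht.1).hasDerivWithinAt) (by simp)
      (fun t ht => (hBd t ht.1).continuousAt.continuousWithinAt)
      (fun t ht => (hBd t ht.1).hasDerivWithinAt)
      (fun t ht heq => by
        have h1 := hrate t ht.1 (hmemball t ht.1 (heq ▸ hBlt t ⟨ht.1, ht.2.le⟩))
        have h2 : ‖x' t‖ ≤ -Ψ' t / c := by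
          rw [le_div_iff₀ hc0]
          linarith
        linarith)
    exact hmemball b hb ((key ⟨hb, le_rfl⟩).trans_lt (hBlt b ⟨hb, le_rfl⟩))
  refine ⟨T, hT0, ?_⟩
  have hint : IntegrableOn Ψ' (Ioi T) :=
    integrableOn_Ioi_deriv_of_nonpos' hΨd (fun t (ht : T < t) => by
      have := hrate t ht.le (htrap t ht.le)
      have : 0 ≤ c * ‖x' t‖ := by positivity
      linarith) hΨlim
  have hmeas : AEStronglyMeasurable x' (volume.restrict (Ioi T)) :=
    (aestronglyMeasurable_deriv x _).congr <| by
      filter_upwards [ae_restrict_mem measurableSet_Ioi] with t ht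
      exact (hx t (hT0.trans (le_of_lt ht))).deriv
  refine (hint.neg.div_const c).mono' hmeas.norm ?_
  filter_upwards [ae_restrict_mem measurableSet_Ioi] with t (ht : T < t)
  rw [norm_norm, Pi.neg_apply, le_div_iff₀ hc0]
  linarith [hrate t ht.le (htrap t ht.le)]

/-- **KL convergence of the flow.** For `g, h ∈ C³`, `f` bounded below,
and a bounded global solution of the continuous DCA flow whose omega-limit set
`ω(x₀) = ⋂_{s ≥ 0} cl{x(t) : t ≥ s}` consists of KL points of `f`, the trajectory has
finite Euclidean length `∫₀^∞ ‖ẋ(t)‖ dt < ∞` and converges to a single critical point. -/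
theorem stmt_7 (n : ℕ) (hn : 1 ≤ n) (μ : ℝ) (hμ : 0 < μ)
    (g h f : EuclideanSpace ℝ (Fin n) → ℝ)
    (hg : ContDiff ℝ 3 g) (hh : ContDiff ℝ 3 h)
    (hf : f = fun z => g z - h z)
    (hsc : ConvexOn ℝ Set.univ (fun x => g x - μ / 2 * ‖x‖ ^ 2))
    (hlow : ∃ B, ∀ z, B ≤ f z)
    (x x' : ℝ → EuclideanSpace ℝ (Fin n))
    (hx : ∀ t, 0 ≤ t → HasDerivAt x (x' t) t ∧
      fderiv ℝ (gradient g) (x t) (x' t) = -gradient f (x t))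
    (hbdd : Bornology.IsBounded (x '' Set.Ici (0:ℝ)))
    (hkl : ∀ p ∈ ⋂ s ∈ Set.Ici (0:ℝ), closure (x '' Set.Ici s), HasKLPropertyAt f p) :
    MeasureTheory.IntegrableOn (fun t => ‖x' t‖) (Set.Ici 0) ∧
    ∃ xs : EuclideanSpace ℝ (Fin n),
      Filter.Tendsto x Filter.atTop (𝓝 xs) ∧ gradient f xs = 0 := by
  have hgC : ContDiff ℝ 2 (gradient g) := hg.gradient (by norm_num)
  have hfC : ContDiff ℝ 3 f := hf ▸ hg.sub hh
  have hfG : Continuous (gradient f) := (hfC.gradient (m := 2) (by norm_num)).continuous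
  have hHess := mul_sq_norm_le_inner_fderiv_gradient (hg.of_le (by norm_num)) hsc
  have hK : IsCompact (closure (x '' Ici 0)) := hbdd.isCompact_closure
  have hxK : ∀ t, 0 ≤ t → x t ∈ closure (x '' Ici 0) := fun t ht =>
    subset_closure (mem_image_of_mem x ht)
  obtain ⟨L, hL0, hL⟩ : ∃ L, 0 < L ∧ ∀ t, 0 ≤ t → ‖gradient f (x t)‖ ≤ L * ‖x' t‖ := by
    obtain ⟨C, hC⟩ := hK.exists_bound_of_continuousOn
      (hgC.continuous_fderiv two_ne_zero).continuousOn
    refine ⟨max C 1, by positivity, fun t ht => ?_⟩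
    rw [← norm_neg, ← (hx t ht).2]
    exact (fderiv ℝ (gradient g) (x t)).le_of_opNorm_le
      ((hC _ (hxK t ht)).trans (le_max_left _ _)) _
  obtain ⟨M, hM⟩ : ∃ M, ∀ t, 0 ≤ t → ‖x' t‖ ≤ M := by
    obtain ⟨C, hC⟩ := hK.exists_bound_of_continuousOn hfG.continuousOn
    refine ⟨C / μ, fun t ht => ?_⟩
    rw [le_div_iff₀ hμ]
    have h1 := hHess (x t) (x' t)
    have h2 := real_inner_le_norm (fderiv ℝ (gradient g) (x t) (x' t)) (x' t)
    rw [(hx t ht).2, norm_neg] at h2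
    rw [(hx t ht).2] at h1
    have h3 := hC _ (hxK t ht)
    by_contra! hlt
    have hpos : 0 < ‖x' t‖ := by
      by_contra! h0
      have := norm_nonneg (gradient f (x t))
      nlinarith
    nlinarith
  have hF : ∀ t, 0 ≤ t → HasDerivAt (fun s => f (x s)) ⟪gradient f (x t), x' t⟫_ℝ t :=
    fun t ht => by
      rw [inner_gradient_left]
      exact (hfC.differentiable three_ne_zero (x t)).hasFDerivAt.comp_hasDerivAt t (hx t ht).1
  have hF' : ∀ t, 0 ≤ t → ⟪gradient f (x t), x' t⟫_ℝ ≤ -(μ * ‖x' t‖ ^ 2) := fun t ht => by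
    have := hHess (x t) (x' t)
    rw [(hx t ht).2, inner_neg_left] at this
    linarith
  have hanti : AntitoneOn (fun t => f (x t)) (Ici 0) := by
    refine antitoneOn_of_deriv_nonpos (convex_Ici 0)
      (fun t ht => (hF t ht).continuousAt.continuousWithinAt) ?_ ?_
    · intro t ht
      rw [interior_Ici] at ht
      exact (hF t (le_of_lt ht)).differentiableAt.differentiableWithinAt
    · intro t ht
      rw [interior_Ici] at ht
      rw [(hF t (le_of_lt ht)).deriv]
      exact (hF' t (le_of_lt ht)).trans (neg_nonpos.2 (by positivity))
  obtain ⟨p, -, hp⟩ := hK.exists_mapClusterPt (f := atTop) (u := x)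
    (le_principal_iff.2 (mem_map.2 (mem_of_superset (Ici_mem_atTop 0) hxK)))
  have hpω : p ∈ ⋂ s ∈ Ici (0 : ℝ), closure (x '' Ici s) := by
    refine mem_iInter₂.2 fun s _ => mem_closure_iff_nhds.2 fun V hV => ?_
    obtain ⟨t, htV, hts⟩ :=
      ((hp.frequently hV).and_eventually (eventually_ge_atTop s)).exists
    exact ⟨x t, htV, mem_image_of_mem x hts⟩
  have hlim : Tendsto (fun t => f (x t)) atTop (𝓝 (f p)) := by
    have hG : Antitone fun t => f (x (max t 0)) := fun a b hab =>
      hanti (le_max_right a 0) (le_max_right b 0) (max_le_max_right 0 hab)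
    obtain ⟨B, hB⟩ := hlow
    have h1 := tendsto_atTop_ciInf hG ⟨B, by rintro _ ⟨t, rfl⟩; exact hB _⟩
    have h2 : Tendsto (fun t => f (x t)) atTop (𝓝 (⨅ t, f (x (max t 0)))) :=
      h1.congr' <| by
        filter_upwards [eventually_ge_atTop 0] with t ht
        rw [max_eq_left ht]
    have h3 : MapClusterPt (f p) atTop (fun t => f (x t)) :=
      hp.continuousAt_comp hfC.continuous.continuousAt
    have heq : f p = ⨅ t, f (x (max t 0)) :=
      eq_of_nhds_neBot (NeBot.mono h3 (inf_le_inf_left _ h2))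
    rwa [← heq] at h2
  obtain ⟨T, hT0, hT⟩ : ∃ T, 0 ≤ T ∧ IntegrableOn (fun t => ‖x' t‖) (Ioi T) := by
    by_cases hpos : ∀ t, 0 ≤ t → f p < f (x t)
    · exact exists_integrableOn_norm_of_hasKLPropertyAt hμ hL0
        (fun t ht => (hx t ht).1) hF hF' hL hp (hkl p hpω) hlim hpos
    · push Not at hpos
      obtain ⟨T, hT0, hT⟩ := hpos
      have hge : ∀ t, 0 ≤ t → f p ≤ f (x t) := fun t ht =>
        le_of_tendsto hlim <| by
          filter_upwards [eventually_ge_atTop t] with s hs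
          exact hanti ht (ht.trans hs) hs
      refine ⟨T, hT0, (integrableOn_zero (μ := volume)).congr_fun (fun t (ht : T < t) => ?_)
        measurableSet_Ioi⟩
      have h0 : 0 ≤ t := hT0.trans ht.le
      have hconst : (fun s => f (x s)) =ᶠ[𝓝 t] fun _ => f p := by
        filter_upwards [Ioi_mem_nhds ht] with s hs
        exact le_antisymm ((hanti hT0 (hT0.trans (le_of_lt hs)) (le_of_lt hs)).trans hT)
          (hge s (hT0.trans (le_of_lt hs)))
      have hz := (hF t h0).unique ((hasDerivAt_const t (f p)).congr_of_eventuallyEq hconst)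
      have h1 := hF' t h0
      rw [hz] at h1
      have h2 : ‖x' t‖ ^ 2 ≤ 0 := by
        by_contra! h
        nlinarith [mul_pos hμ h]
      exact (pow_eq_zero_iff two_ne_zero |>.1 (le_antisymm h2 (sq_nonneg _))).symm
  have hmeas : AEStronglyMeasurable x' (volume.restrict (Ici 0)) :=
    (aestronglyMeasurable_deriv x _).congr <| by
      filter_upwards [ae_restrict_mem measurableSet_Ici] with t ht
      exact (hx t ht).1.deriv
  have hint : IntegrableOn (fun t => ‖x' t‖) (Ici 0) := by
    rw [← Icc_union_Ioi_eq_Ici hT0]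
    refine IntegrableOn.union ?_ hT
    refine (integrableOn_const (C := M) (by simp)).mono'
      (hmeas.mono_measure (Measure.restrict_mono Icc_subset_Ici_self le_rfl)).norm ?_
    filter_upwards [ae_restrict_mem measurableSet_Icc] with t ht
    rw [norm_norm]
    exact hM t ht.1
  have hintx : IntegrableOn x' (Ioi 0) :=
    IntegrableOn.mono_set ((integrable_norm_iff hmeas).1 hint) Ioi_subset_Ici_self
  have hconv := tendsto_limUnder_of_hasDerivAt_of_integrableOn_Ioi
    (fun t (ht : 0 < t) => (hx t ht.le).1) hintx
  refine ⟨hint, _, hconv, ?_⟩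
  by_contra hne
  set xs := limUnder atTop x
  have hδ : 0 < ‖gradient f xs‖ := norm_pos_iff.2 hne
  have hev : ∀ᶠ t in atTop, ‖gradient f xs‖ / 2 < ‖gradient f (x t)‖ :=
    ((hfG.tendsto xs).comp hconv).norm.eventually_const_lt (half_lt_self hδ)
  obtain ⟨S, hS⟩ := eventually_atTop.1 (hev.and (eventually_ge_atTop 0))
  have hS0 : 0 ≤ S := (hS S le_rfl).2
  have hcon : IntegrableOn (fun _ : ℝ => ‖gradient f xs‖ / 2 / L) (Ici S) := by
    refine (hint.mono_set (Ici_subset_Ici.2 hS0)).mono' aestronglyMeasurable_const ?_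
    filter_upwards [ae_restrict_mem measurableSet_Ici] with t ht
    rw [Real.norm_of_nonneg (by positivity), div_le_iff₀ hL0, mul_comm]
    exact (hS t ht).1.le.trans (hL t (hS0.trans ht))
  rw [integrableOn_const_iff] at hcon
  rcases hcon with h | h
  · exact (by positivity : ‖gradient f xs‖ / 2 / L ≠ 0) (by simpa using h)
  · simp at h
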